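/- Let G be an Artin group on generators a₁,…,aₙ with all labels m_{ij} ≥ 4. If {i,j} and {t,k} are disjoint pairs of indices with m_{ij}, m_{tk} < ∞, then the parabolic subgroups G_{ij} = ⟨a_i, a_j⟩ and G_{tk} = ⟨a_t, a_k⟩ intersect trivially in G. -/

import Mathlib

/-- The alternating word `x y x y ⋯` with `m` letters, in the free group. -/
def altWord {σ : Type*} (x y : σ) : ℕ → FreeGroup σ
  | 0 => 1
  | m + 1 => FreeGroup.of x * altWord y x m

/-- The defining relators `u_{ij} u_{ji}⁻¹` of the Artin group with Coxeter-type
labels `M : Fin n → Fin n → ℕ∞` (relations with `M i j = ∞` are omitted). -/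
def artinRels (n : ℕ) (M : Fin n → Fin n → ℕ∞) : Set (FreeGroup (Fin n)) :=
  { r | ∃ i j : Fin n, i ≠ j ∧ ∃ m : ℕ, M i j = (m : ℕ∞) ∧
      r = altWord i j m * (altWord j i m)⁻¹ }

/-- The quotient map from the free group onto the Artin group with labels `M`. -/
def artinMk (n : ℕ) (M : Fin n → Fin n → ℕ∞) :
    FreeGroup (Fin n) →* PresentedGroup (artinRels n M) :=
  PresentedGroup.mk _


namespace ArtinAux

open Polynomial.Chebyshev in
theorem S_vanish (m : ℕ) (hm : 3 ≤ m) (t : ℝ) (ht : t = 2 * Real.cos (2 * Real.pi / m)) :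
    (S ℝ (((m:ℤ) - 2) / 2)).eval t * ((S ℝ (((m:ℤ) - 1) / 2)).eval t + (S ℝ (((m:ℤ) - 3) / 2)).eval t) = 0 ∧
    (S ℝ (((m:ℤ) - 1) / 2)).eval t * ((S ℝ ((m:ℤ) / 2)).eval t + (S ℝ (((m:ℤ) - 2) / 2)).eval t) = 0 := by
  set θ := 2 * Real.pi / m with hθ
  have hm0 : (0:ℝ) < m := by positivity
  have hs : Real.sin θ ≠ 0 := by
    apply ne_of_gt
    apply Real.sin_pos_of_pos_of_lt_pi
    · positivity
    · rw [hθ, div_lt_iff₀ hm0]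
      have : (3:ℝ) ≤ m := by exact_mod_cast hm
      nlinarith [Real.pi_pos]
  have hS : ∀ k : ℤ, (S ℝ k).eval t * Real.sin θ = Real.sin ((k + 1) * θ) := by
    intro k; rw [ht]; exact S_two_mul_real_cos θ k
  have hmθ : (m:ℝ) * θ = 2 * Real.pi := by rw [hθ]; field_simp
  rcases Nat.even_or_odd' m with ⟨q, rfl | rfl⟩
  · have e1 : (((2 * q : ℕ):ℤ) - 2) / 2 = q - 1 := by omega
    have e2 : (((2 * q : ℕ):ℤ) - 1) / 2 = q - 1 := by omega
    have z : (S ℝ ((q:ℤ) - 1)).eval t = 0 := by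
      have := hS (q - 1)
      have h2 : (((q - 1 : ℤ) : ℝ) + 1) * θ = Real.pi := by
        push_cast at *; linarith
      rw [h2, Real.sin_pi] at this
      exact (mul_eq_zero.1 this).resolve_right hs
    rw [e1, e2, z]; simp
  · have e1 : (((2 * q + 1 : ℕ):ℤ) - 2) / 2 = q - 1 := by omega
    have e2 : (((2 * q + 1 : ℕ):ℤ) - 1) / 2 = q := by omega
    have e3 : (((2 * q + 1 : ℕ):ℤ) - 3) / 2 = q - 1 := by omega
    have e4 : (((2 * q + 1 : ℕ):ℤ)) / 2 = q := by omega
    have z : (S ℝ (q:ℤ)).eval t + (S ℝ ((q:ℤ) - 1)).eval t = 0 := by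
      have h1 := hS q
      have h2 := hS (q - 1)
      have h3 : (((q : ℤ) : ℝ) + 1) * θ = 2 * Real.pi - (((q - 1 : ℤ) : ℝ) + 1) * θ := by
        push_cast at *; linarith
      rw [h3, Real.sin_two_pi_sub] at h1
      have : ((S ℝ (q:ℤ)).eval t + (S ℝ ((q:ℤ) - 1)).eval t) * Real.sin θ = 0 := by
        rw [add_mul, h1, h2]; ring
      exact (mul_eq_zero.1 this).resolve_right hs
    rw [e1, e2, e3, e4, z]; simp

/-- the linear form of the geometric representation -/
noncomputable def gform {n : ℕ} (C : CoxeterMatrix (Fin n)) (s : Fin n) : Module.Dual ℝ (Fin n → ℝ) :=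
  ∑ t : Fin n, (-2 * Real.cos (Real.pi / C s t)) • LinearMap.proj t

theorem gform_single {n : ℕ} (C : CoxeterMatrix (Fin n)) (s t : Fin n) :
    gform C s (Pi.single t 1) = -2 * Real.cos (Real.pi / C s t) := by
  simp [gform, LinearMap.sum_apply, Pi.single_apply]

theorem gform_self {n : ℕ} (C : CoxeterMatrix (Fin n)) (s : Fin n) :
    gform C s (Pi.single s 1) = 2 := by
  rw [gform_single]; simp

theorem gform_mul {n : ℕ} (C : CoxeterMatrix (Fin n)) (s t : Fin n) :
    2 * Real.cos (2 * Real.pi / C s t) =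
      gform C s (Pi.single t 1) * gform C t (Pi.single s 1) - 2 := by
  rw [gform_single, gform_single, C.symmetric t s]
  have : 2 * Real.pi / (C s t : ℝ) = 2 * (Real.pi / C s t) := by ring
  rw [this, Real.cos_two_mul]; ring

noncomputable def gref {n : ℕ} (C : CoxeterMatrix (Fin n)) (s : Fin n) :
    (Fin n → ℝ) ≃ₗ[ℝ] (Fin n → ℝ) := Module.reflection (gform_self C s)

theorem gref_liftable {n : ℕ} (C : CoxeterMatrix (Fin n))
    (h3 : ∀ i j, i ≠ j → C i j = 0 ∨ 3 ≤ C i j) : C.IsLiftable (gref C) := by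
  intro s t
  by_cases hst : s = t
  · subst hst
    rw [C.diagonal, pow_one]
    ext1 v
    exact Module.involutive_reflection (gform_self C s) v
  rcases h3 s t hst with h | h
  · rw [h, pow_zero]
  · ext1 v
    have := Module.reflection_mul_reflection_pow_apply (gform_self C s) (gform_self C t) (C s t) v
      (2 * Real.cos (2 * Real.pi / C s t)) (gform_mul C s t)
    obtain ⟨h1, h2⟩ := S_vanish (C s t) h _ rfl
    rw [h1, h2] at this
    simpa [gref] using this

variable {n : ℕ} (C : CoxeterMatrix (Fin n)) {W : Type} [Group W] (cs : CoxeterSystem C W)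

theorem simple_inj (h3 : ∀ i j, i ≠ j → C i j = 0 ∨ 3 ≤ C i j) :
    Function.Injective cs.simple := by
  intro s t hst
  by_contra hne
  have := congrArg (fun w => cs.lift ⟨gref C, gref_liftable C h3⟩ w (Pi.single s 1) s) hst
  simp only [cs.lift_apply_simple, gref, Module.reflection_apply, gform_self] at this
  simp [hne] at this

theorem dvd_of_pow_eq_one (h3 : ∀ i j, i ≠ j → C i j = 0 ∨ 3 ≤ C i j) (s t : Fin n) (hst : s ≠ t)
    (h0 : C s t ≠ 0) (k : ℕ) (hk : (cs.simple s * cs.simple t) ^ k = 1) : C s t ∣ k := by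
  have hm : 3 ≤ C s t := (h3 s t hst).resolve_left h0
  have h1 := congrArg (fun w => cs.lift ⟨gref C, gref_liftable C h3⟩ w (Pi.single s 1)) hk
  simp only [map_pow, map_mul, cs.lift_apply_simple, map_one] at h1
  have h2 := Module.reflection_mul_reflection_pow_apply_self (gform_self C s) (gform_self C t) k
      (2 * Real.cos (2 * Real.pi / C s t)) (gform_mul C s t)
  unfold gref at h1
  rw [h2] at h1
  set θ := 2 * Real.pi / (C s t : ℝ) with hθ
  have hm0 : (0:ℝ) < C s t := by positivity
  have hm3 : (3:ℝ) ≤ C s t := by exact_mod_cast hm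
  have hs : Real.sin θ ≠ 0 := by
    apply ne_of_gt
    apply Real.sin_pos_of_pos_of_lt_pi
    · positivity
    · rw [hθ, div_lt_iff₀ hm0]
      nlinarith [Real.pi_pos]
  have hc : gform C t (Pi.single s 1) ≠ 0 := by
    rw [gform_single, C.symmetric t s]
    have : 0 < Real.cos (Real.pi / C s t) := by
      apply Real.cos_pos_of_mem_Ioo
      constructor
      · have : 0 < Real.pi / C s t := by positivity
        linarith [Real.pi_pos]
      · rw [div_lt_iff₀ hm0]; nlinarith [Real.pi_pos]
    nlinarith
  have et := congrFun h1 t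
  have es := congrFun h1 s
  simp [hst, Ne.symm hst] at et es
  have ek1 := Polynomial.Chebyshev.S_two_mul_real_cos θ ((k:ℤ) - 1)
  have ek := Polynomial.Chebyshev.S_two_mul_real_cos θ (k:ℤ)
  have et' := et.resolve_right hc
  rw [et', add_zero] at es
  rw [et'] at ek1
  rw [es] at ek
  push_cast at ek ek1
  simp only [zero_mul, sub_add_cancel, one_mul] at ek ek1
  rw [add_mul, one_mul, Real.sin_add, ← ek1, zero_mul, zero_add] at ek
  have hcos : Real.cos (k * θ) = 1 := mul_right_cancel₀ hs (by linarith)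
  obtain ⟨l, hl⟩ := (Real.cos_eq_one_iff _).1 hcos
  have : (l : ℝ) * C s t = k := by
    rw [hθ] at hl
    field_simp at hl
    exact hl
  have h5 : l * (C s t : ℤ) = k := by exact_mod_cast this
  exact Int.natCast_dvd_natCast.1 ⟨l, by rw [← h5, mul_comm]⟩


variable {C}

open Classical in
/-- Tits sign permutation -/
noncomputable def tperm (s : Fin n) : Equiv.Perm (W × ZMod 2) :=
  Function.Involutive.toPerm
    (fun p => (cs.simple s * p.1 * cs.simple s, p.2 + if p.1 = cs.simple s then 1 else 0))
    (by
      rintro ⟨r, e⟩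
      have h : (cs.simple s * r * cs.simple s = cs.simple s) ↔ r = cs.simple s := by
        constructor
        · intro h
          have := congrArg (fun x => cs.simple s * x * cs.simple s) h
          simpa [mul_assoc] using this
        · rintro rfl; simp
      ext
      · simp [mul_assoc]
      · simp only [h]
        by_cases hr : r = cs.simple s
        · simp only [hr, if_true, add_assoc]
          rw [show (1 + 1 : ZMod 2) = 0 from rfl, add_zero]
        · simp [hr])

open Classical in
theorem tperm_apply (s : Fin n) (r : W) (e : ZMod 2) :
    tperm cs s (r, e) = (cs.simple s * r * cs.simple s, e + if r = cs.simple s then 1 else 0) := rfl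

open Classical in
theorem tperm_pow (s t : Fin n) (k : ℕ) (r : W) (e : ZMod 2) :
    ((tperm cs s * tperm cs t) ^ k) (r, e) =
      ((cs.simple s * cs.simple t) ^ k * r * ((cs.simple t * cs.simple s) ^ k),
        e + ∑ q ∈ Finset.range (2 * k),
          if r = (cs.simple t * cs.simple s) ^ q * cs.simple t then 1 else 0) := by
  induction k with
  | zero => simp
  | succ k ih =>
    rw [pow_succ', Equiv.Perm.mul_apply, ih, Equiv.Perm.mul_apply, tperm_apply, tperm_apply]
    have hab : cs.simple s * cs.simple t = (cs.simple t * cs.simple s)⁻¹ := by simp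
    have hsc : SemiconjBy (cs.simple t) ((cs.simple t * cs.simple s)⁻¹) (cs.simple t * cs.simple s) := by
      simp [SemiconjBy, mul_assoc]
    have hsck : cs.simple t * ((cs.simple t * cs.simple s)^k)⁻¹
        = (cs.simple t * cs.simple s) ^ k * cs.simple t := by
      have := (hsc.pow_right k).eq
      rwa [inv_pow] at this
    have h1 : ((cs.simple s * cs.simple t) ^ k * r * ((cs.simple t * cs.simple s) ^ k)
        = cs.simple t) ↔ r = (cs.simple t * cs.simple s) ^ (2 * k) * cs.simple t := by
      rw [hab, inv_pow, two_mul, pow_add, mul_assoc ((cs.simple t * cs.simple s) ^ k),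
        ← hsck, mul_assoc, inv_mul_eq_iff_eq_mul, ← mul_assoc, eq_mul_inv_iff_mul_eq]
    have h2 : (cs.simple t * ((cs.simple s * cs.simple t) ^ k * r * ((cs.simple t * cs.simple s) ^ k))
        * cs.simple t = cs.simple s) ↔
        r = (cs.simple t * cs.simple s) ^ (2 * k + 1) * cs.simple t := by
      have h3 : ∀ x : W, cs.simple t * x * cs.simple t = cs.simple s ↔
          x = cs.simple t * cs.simple s * cs.simple t := by
        intro x
        constructor
        · intro h; rw [← h]; simp [mul_assoc]
        · rintro rfl; simp [mul_assoc]
      rw [h3, hab, inv_pow, show 2 * k + 1 = k + 1 + k by ring, pow_add, pow_succ,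
        mul_assoc ((cs.simple t * cs.simple s) ^ k * _),
        ← hsck, mul_assoc, inv_mul_eq_iff_eq_mul, ← mul_assoc, ← eq_mul_inv_iff_mul_eq]
      simp only [mul_assoc]
    ext
    · simp only [pow_succ' (cs.simple s * cs.simple t), pow_succ (cs.simple t * cs.simple s)]
      simp only [mul_assoc]
    · simp only [h1, h2]
      rw [show 2 * (k + 1) = 2 * k + 1 + 1 by ring, Finset.sum_range_succ, Finset.sum_range_succ]
      ring

theorem tperm_liftable : C.IsLiftable (tperm cs) := by
  classical
  intro s t
  ext1 ⟨r, e⟩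
  rw [tperm_pow]
  have h1 := cs.simple_mul_simple_pow s t
  have h2 := cs.simple_mul_simple_pow' s t
  rw [h1, h2, two_mul, Finset.sum_range_add]
  simp only [pow_add, h2, one_mul, mul_one]
  ext
  · simp
  · simp only [Equiv.Perm.coe_one, id]
    rw [CharTwo.add_self_eq_zero, add_zero]

/-- the inversion cocycle -/
noncomputable def eta (w r : W) : ZMod 2 := (cs.lift ⟨tperm cs, tperm_liftable cs⟩ w (r, 0)).2

theorem eta_spec (w : W) : ∀ (r : W) (e : ZMod 2), cs.lift ⟨tperm cs, tperm_liftable cs⟩ w (r, e)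
    = (w * r * w⁻¹, e + eta cs w r) := by
  unfold eta
  induction w using cs.simple_induction with
  | simple i => intro r e; simp [cs.lift_apply_simple, tperm_apply]
  | one => simp
  | mul u v hu hv =>
    intro r e
    rw [map_mul, Equiv.Perm.mul_apply, Equiv.Perm.mul_apply, hv, hu, hv r 0, hu _ (0 + _)]
    ext
    · simp [mul_assoc]
    · simp [add_assoc]

theorem eta_mul (u v r : W) : eta cs (u * v) r = eta cs v r + eta cs u (v * r * v⁻¹) := by
  have h := eta_spec cs (u * v) r 0
  rw [map_mul, Equiv.Perm.mul_apply, eta_spec, eta_spec] at h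
  have := congrArg Prod.snd h
  simpa using this.symm

theorem eta_one (r : W) : eta cs 1 r = 0 := by simp [eta]

open Classical in
theorem eta_simple (s : Fin n) (r : W) : eta cs (cs.simple s) r = if r = cs.simple s then 1 else 0 := by
  simp [eta, cs.lift_apply_simple, tperm_apply]

theorem eta_inv (w r : W) : eta cs w⁻¹ r = eta cs w (w⁻¹ * r * w) := by
  have h := eta_mul cs w w⁻¹ r
  rw [mul_inv_cancel, eta_one, inv_inv] at h
  exact (CharTwo.add_eq_zero.1 h.symm)

theorem exchange (ω : List (Fin n)) (r : W) (h : eta cs (cs.wordProd ω) r ≠ 0) :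
    ∃ ω' : List (Fin n), ω'.Sublist ω ∧ ω'.length < ω.length ∧ cs.wordProd ω * r = cs.wordProd ω' := by
  induction ω with
  | nil => simp [eta_one] at h
  | cons s ω ih =>
    rw [cs.wordProd_cons, eta_mul] at h
    by_cases h0 : eta cs (cs.wordProd ω) r = 0
    · rw [h0, zero_add, eta_simple] at h
      have h1 : cs.wordProd ω * r * (cs.wordProd ω)⁻¹ = cs.simple s := by
        by_contra hh; simp [hh] at h
      refine ⟨ω, List.sublist_cons_self _ _, by simp, ?_⟩
      rw [cs.wordProd_cons, mul_assoc, mul_inv_eq_iff_eq_mul.1 h1]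
      simp
    · obtain ⟨ω', h1, h2, h3⟩ := ih h0
      exact ⟨s :: ω', h1.cons_cons s, by simpa using h2, by
        rw [cs.wordProd_cons, cs.wordProd_cons, mul_assoc, h3]⟩

/-- standard parabolic subgroup -/
def par (L : Set (Fin n)) : Subgroup W := Subgroup.closure (cs.simple '' L)

theorem mem_par {L : Set (Fin n)} {u : W} (hu : u ∈ par cs L) :
    ∃ ω : List (Fin n), (∀ s ∈ ω, s ∈ L) ∧ cs.wordProd ω = u := by
  induction hu using Subgroup.closure_induction with
  | mem x hx =>
    obtain ⟨s, hs, rfl⟩ := hx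
    exact ⟨[s], by simpa using hs, by simp⟩
  | one => exact ⟨[], by simp, by simp⟩
  | mul x y _ _ hx hy =>
    obtain ⟨a, ha, rfl⟩ := hx
    obtain ⟨b, hb, rfl⟩ := hy
    refine ⟨a ++ b, ?_, cs.wordProd_append a b⟩
    intro s hs
    rcases List.mem_append.1 hs with h | h
    exacts [ha s h, hb s h]
  | inv x _ hx =>
    obtain ⟨a, ha, rfl⟩ := hx
    exact ⟨a.reverse, by simpa using ha, cs.wordProd_reverse a⟩

theorem simple_mem_par {L : Set (Fin n)} {s : Fin n} (hs : s ∈ L) : cs.simple s ∈ par cs L :=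
  Subgroup.subset_closure ⟨s, hs, rfl⟩

theorem par_eq_one {L : Set (Fin n)} {u : W} (hu : u ∈ par cs L)
    (h : ∀ s ∈ L, eta cs u (cs.simple s) = 0) : u = 1 := by
  classical
  have hex : ∃ k, ∃ ω : List (Fin n), (∀ s ∈ ω, s ∈ L) ∧ cs.wordProd ω = u ∧ ω.length = k := by
    obtain ⟨ω, h1, h2⟩ := mem_par cs hu
    exact ⟨_, ω, h1, h2, rfl⟩
  obtain ⟨ω, h1, h2, h3⟩ := Nat.find_spec hex
  rcases List.eq_nil_or_concat ω with rfl | ⟨ω₀, s, rfl⟩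
  · simpa using h2.symm
  exfalso
  have hs : s ∈ L := h1 s (by simp)
  have hu' : u = cs.wordProd ω₀ * cs.simple s := by rw [← h2]; simp [cs.wordProd_append]
  have he := h s hs
  rw [hu', eta_mul, eta_simple] at he
  simp only [if_true, cs.inv_simple, cs.simple_mul_simple_cancel_right] at he
  have hne : eta cs (cs.wordProd ω₀) (cs.simple s) ≠ 0 := by
    intro h0; rw [h0] at he; simp at he
  obtain ⟨ω', hsub, hlen, hprod⟩ := exchange cs ω₀ _ hne
  refine Nat.find_min hex (m := ω'.length) ?_ ⟨ω', ?_, ?_, rfl⟩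
  · rw [← h3]; simp; omega
  · intro x hx; exact h1 x (by simp [hsub.subset hx])
  · rw [← hprod, hu']

theorem par_simple {L : Set (Fin n)} {u c : W} (hu : u ∈ par cs L) (hc : c ∈ par cs L)
    (h : ∀ r ∈ par cs L, eta cs u r ≠ 0 ↔ r = c) : ∃ s ∈ L, u = cs.simple s := by
  by_cases hall : ∀ s ∈ L, eta cs u (cs.simple s) = 0
  · exfalso
    have := par_eq_one cs hu hall
    subst this
    exact (h c hc).2 rfl (eta_one cs c)
  push Not at hall
  obtain ⟨s, hs, hne⟩ := hall
  have hsc := (h _ (simple_mem_par cs hs)).1 hne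
  refine ⟨s, hs, ?_⟩
  have hsL := simple_mem_par cs hs
  have : u * cs.simple s = 1 := by
    apply par_eq_one cs (mul_mem hu hsL)
    intro t ht
    have htL := simple_mem_par cs ht
    rw [eta_mul, eta_simple, cs.inv_simple]
    by_cases hts : cs.simple t = cs.simple s
    · rw [hts]
      simp only [if_true, cs.simple_mul_simple_cancel_right]
      have : ∀ x : ZMod 2, x ≠ 0 → 1 + x = 0 := by decide
      exact this _ hne
    · rw [if_neg hts, zero_add]
      by_contra hh
      have h5 := (h _ (mul_mem (mul_mem hsL htL) hsL)).1 hh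
      rw [← hsc] at h5
      apply hts
      have := congrArg (fun x => cs.simple s * x * cs.simple s) h5
      simpa [mul_assoc] using this
  rw [← mul_left_inj (cs.simple s), this, cs.simple_mul_simple_self]


/-- alternating product `⋯ b a b a`, with `k` factors, last factor `a` -/
def ralt {H : Type*} [Group H] (a b : H) : ℕ → H
  | 0 => 1
  | k + 1 => ralt b a k * a

theorem ralt_succ_left {H : Type*} [Group H] (a b : H) (k : ℕ) :
    ralt a b (k + 1) = (if Even k then a else b) * ralt a b k := by
  induction k generalizing a b with
  | zero => simp [ralt]
  | succ k ih =>
    rw [ralt, ih b a, ralt, mul_assoc]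
    by_cases h : Even k
    · have h' : ¬ Even (k + 1) := by simpa [Nat.even_add_one] using h
      simp [h, h']
    · have h' : Even (k + 1) := by simpa [Nat.even_add_one] using h
      simp [h, h']

theorem lift_altWord {σ H : Type*} [Group H] (f : σ → H) (x y : σ) (m : ℕ) :
    FreeGroup.lift f (altWord x y m) =
      if Even m then ralt (f y) (f x) m else ralt (f x) (f y) m := by
  induction m generalizing x y with
  | zero => simp [altWord, ralt]
  | succ m ih =>
    rw [altWord, map_mul, ih y x, FreeGroup.lift_apply_of]
    by_cases h : Even m
    · have h' : ¬ Even (m + 1) := by simpa [Nat.even_add_one] using h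
      simp [h, h', ralt_succ_left]
    · have h' : Even (m + 1) := by simpa [Nat.even_add_one] using h
      simp [h, h', ralt_succ_left]

theorem lift_altWord_eq_iff {σ H : Type*} [Group H] (f : σ → H) (x y : σ) (m : ℕ) :
    FreeGroup.lift f (altWord x y m) = FreeGroup.lift f (altWord y x m) ↔
      ralt (f x) (f y) m = ralt (f y) (f x) m := by
  rw [lift_altWord, lift_altWord]
  split_ifs
  · exact eq_comm
  · rfl

theorem ralt_swap {H : Type*} [Group H] (a b : H) (ha : a * a = 1) (hb : b * b = 1) (k : ℕ) :
    ralt b a k = ralt a b k * (a * b) ^ k := by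
  induction k generalizing a b with
  | zero => simp [ralt]
  | succ k ih =>
    rw [ralt, ralt, ih b a hb ha]
    have hsc : SemiconjBy b (a * b) (b * a) := by simp [SemiconjBy, mul_assoc]
    have := (hsc.pow_right k).eq
    rw [mul_assoc, ← this, pow_succ', mul_assoc, ← mul_assoc a, ← mul_assoc a, ha, one_mul]

/-- minimal coset representatives -/
def IsMin (X : Set (Fin n)) (w : W) : Prop := ∀ r ∈ par cs X, eta cs w r = 0

theorem isMin_one (X : Set (Fin n)) : IsMin cs X 1 := fun r _ => eta_one cs r

theorem isMin_move {X : Set (Fin n)} {w : W} (hw : IsMin cs X w) {s : Fin n}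
    (h : w⁻¹ * cs.simple s * w ∉ par cs X) : IsMin cs X (cs.simple s * w) := by
  intro r hr
  rw [eta_mul, hw r hr, zero_add, eta_simple, if_neg]
  intro h1
  apply h
  rw [← h1]
  simpa [mul_assoc] using hr

theorem isMin_loop {X : Set (Fin n)} {w : W} (hw : IsMin cs X w) {s : Fin n}
    (h : w⁻¹ * cs.simple s * w ∈ par cs X) : ∃ x ∈ X, w⁻¹ * cs.simple s * w = cs.simple x := by
  classical
  apply par_simple cs h h
  intro r hr
  have h1 := eta_mul cs w (w⁻¹ * cs.simple s * w) r
  rw [hw _ (mul_mem (mul_mem h hr) (inv_mem h)), add_zero,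
    show w * (w⁻¹ * cs.simple s * w) = cs.simple s * w by group, eta_mul, hw r hr, zero_add,
    eta_simple] at h1
  rw [← h1]
  have : w * r * w⁻¹ = cs.simple s ↔ r = w⁻¹ * cs.simple s * w := by
    constructor
    · intro h; rw [← h]; group
    · intro h; rw [h]; group
  simp [this]

open Classical in
noncomputable def labOf {A : Type} [Group A] (a : Fin n → A) (X : Set (Fin n)) (y : W) : A :=
  if h : ∃ x ∈ X, y = cs.simple x then a h.choose else 1

theorem labOf_simple {A : Type} [Group A] (a : Fin n → A) (X : Set (Fin n))
    (hinj : Function.Injective cs.simple) {x : Fin n} (hx : x ∈ X) :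
    labOf cs a X (cs.simple x) = a x := by
  have h : ∃ x' ∈ X, cs.simple x = cs.simple x' := ⟨x, hx, rfl⟩
  rw [labOf, dif_pos h, hinj h.choose_spec.2.symm]

open Classical in
noncomputable def act {A : Type} [Group A] (a : Fin n → A) (X : Set (Fin n)) (s : Fin n) :
    Equiv.Perm (A × {w : W // IsMin cs X w}) where
  toFun p := if h : p.2.1⁻¹ * cs.simple s * p.2.1 ∈ par cs X then
      (labOf cs a X (p.2.1⁻¹ * cs.simple s * p.2.1) * p.1, p.2)
    else (p.1, ⟨cs.simple s * p.2.1, isMin_move cs p.2.2 h⟩)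
  invFun p := if h : p.2.1⁻¹ * cs.simple s * p.2.1 ∈ par cs X then
      ((labOf cs a X (p.2.1⁻¹ * cs.simple s * p.2.1))⁻¹ * p.1, p.2)
    else (p.1, ⟨cs.simple s * p.2.1, isMin_move cs p.2.2 h⟩)
  left_inv := by
    rintro ⟨α, w, hw⟩
    by_cases h : w⁻¹ * cs.simple s * w ∈ par cs X
    · simp [h]
    · have h' : ¬ (cs.simple s * w)⁻¹ * cs.simple s * (cs.simple s * w) ∈ par cs X := by
        simpa [mul_assoc] using h
      simp only [h, h', dite_false]
      simp
  right_inv := by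
    rintro ⟨α, w, hw⟩
    by_cases h : w⁻¹ * cs.simple s * w ∈ par cs X
    · simp [h]
    · have h' : ¬ (cs.simple s * w)⁻¹ * cs.simple s * (cs.simple s * w) ∈ par cs X := by
        simpa [mul_assoc] using h
      simp only [h, h', dite_false]
      simp

section
variable {A : Type} [Group A] (a : Fin n → A) (X : Set (Fin n))

theorem act_loop {s : Fin n} (α : A) (w : {w : W // IsMin cs X w})
    (h : w.1⁻¹ * cs.simple s * w.1 ∈ par cs X) :
    act cs a X s (α, w) = (labOf cs a X (w.1⁻¹ * cs.simple s * w.1) * α, w) := by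
  simp [act, h]

theorem act_move {s : Fin n} (α : A) (w : {w : W // IsMin cs X w})
    (h : w.1⁻¹ * cs.simple s * w.1 ∉ par cs X) :
    act cs a X s (α, w) = (α, ⟨cs.simple s * w.1, isMin_move cs w.2 h⟩) := by
  simp [act, h]

theorem act_symm_move {s : Fin n} (α : A) (w : {w : W // IsMin cs X w})
    (h : w.1⁻¹ * cs.simple s * w.1 ∉ par cs X) :
    (act cs a X s)⁻¹ (α, w) = (α, ⟨cs.simple s * w.1, isMin_move cs w.2 h⟩) := by
  change (act cs a X s).symm (α, w) = _
  simp [act, h]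

/-- reflections of the dihedral subgroup -/
def rf (s t : Fin n) (q : ℤ) : W := (cs.simple s * cs.simple t) ^ q * cs.simple s

theorem rf_zero (s t : Fin n) : rf cs s t 0 = cs.simple s := by simp [rf]

theorem rf_swap (s t : Fin n) (q : ℤ) : rf cs t s q = rf cs s t (-q - 1) := by
  have h : cs.simple t * cs.simple s = (cs.simple s * cs.simple t)⁻¹ := by simp
  rw [rf, rf, h, inv_zpow', zpow_sub, zpow_one]
  simp [mul_assoc]

theorem rf_conj (s t : Fin n) (q : ℤ) :
    cs.simple s * rf cs t s q * cs.simple s = rf cs s t (q + 1) := by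
  have hsc : SemiconjBy (cs.simple s) (cs.simple t * cs.simple s) (cs.simple s * cs.simple t) := by
    simp [SemiconjBy, mul_assoc]
  have := (hsc.zpow_right q).eq
  rw [rf, rf, ← mul_assoc, this, zpow_add_one]
  simp [mul_assoc]

theorem rf_conj' (s t : Fin n) (q : ℤ) (w : W) :
    (cs.simple s * w)⁻¹ * rf cs t s q * (cs.simple s * w) = w⁻¹ * rf cs s t (q + 1) * w := by
  rw [← rf_conj]; simp [mul_assoc]

theorem rf_eq_iff (s t : Fin n) (p q : ℤ) :
    rf cs s t p = rf cs s t q ↔ ((orderOf (cs.simple s * cs.simple t) : ℕ) : ℤ) ∣ p - q := by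
  rw [rf, rf, mul_left_inj, orderOf_dvd_iff_zpow_eq_one, zpow_sub, mul_inv_eq_one]

theorem orderOf_swap (s t : Fin n) :
    orderOf (cs.simple t * cs.simple s) = orderOf (cs.simple s * cs.simple t) := by
  rw [← orderOf_inv]; simp

theorem walk_none (k : ℕ) (s t : Fin n) (α : A) (w : {w : W // IsMin cs X w})
    (h : ∀ q : ℕ, q < k → w.1⁻¹ * rf cs s t q * w.1 ∉ par cs X) :
    (ralt (act cs a X s) (act cs a X t) k (α, w)).1 = α ∧
    (ralt (act cs a X s) (act cs a X t) k (α, w)).2.1 = ralt (cs.simple s) (cs.simple t) k * w.1 := by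
  induction k generalizing s t w with
  | zero => simp [ralt]
  | succ k ih =>
    have h0 := h 0 (by omega)
    rw [Nat.cast_zero, rf_zero] at h0
    rw [ralt, Equiv.Perm.mul_apply, act_move cs a X α w h0, ralt, mul_assoc]
    apply ih
    intro q hq
    have := h (q + 1) (by omega)
    dsimp only
    rwa [rf_conj']

theorem walk_one (k : ℕ) (s t : Fin n) (hk : k ≤ orderOf (cs.simple s * cs.simple t))
    (α : A) (w : {w : W // IsMin cs X w}) (p : ℕ) (hp : p < k)
    (hl : w.1⁻¹ * rf cs s t p * w.1 ∈ par cs X)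
    (H : ∀ q : ℤ, w.1⁻¹ * rf cs s t q * w.1 ∈ par cs X → rf cs s t q = rf cs s t p) :
    (ralt (act cs a X s) (act cs a X t) k (α, w)).1 =
      labOf cs a X (w.1⁻¹ * rf cs s t p * w.1) * α ∧
    (ralt (act cs a X s) (act cs a X t) k (α, w)).2.1 =
      ralt (cs.simple s) (cs.simple t) k * rf cs s t p * w.1 := by
  induction k generalizing s t w p with
  | zero => omega
  | succ k ih =>
    rcases p with _ | p
    · simp only [Nat.cast_zero, rf_zero] at hl H ⊢
      rw [ralt, Equiv.Perm.mul_apply, act_loop cs a X α w hl, ralt,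
        cs.simple_mul_simple_cancel_right]
      apply walk_none
      intro q hq hmem
      rw [rf_swap] at hmem
      have h1 := H _ hmem
      rw [← rf_zero cs s t, rf_eq_iff] at h1
      obtain ⟨c, hc⟩ := h1
      have h2 : ((orderOf (cs.simple s * cs.simple t) : ℕ) : ℤ) ∣ ((q + 1 : ℕ) : ℤ) :=
        ⟨-c, by push_cast; linarith⟩
      have h3 := Nat.le_of_dvd (by omega) (Int.natCast_dvd_natCast.1 h2)
      omega
    · have h0 : w.1⁻¹ * cs.simple s * w.1 ∉ par cs X := by
        intro h0
        have h1 := H 0 (by rwa [rf_zero])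
        rw [rf_eq_iff] at h1
        obtain ⟨c, hc⟩ := h1
        have h2 : ((orderOf (cs.simple s * cs.simple t) : ℕ) : ℤ) ∣ ((p + 1 : ℕ) : ℤ) :=
          ⟨-c, by push_cast at *; linarith⟩
        have h3 := Nat.le_of_dvd (by omega) (Int.natCast_dvd_natCast.1 h2)
        omega
      rw [ralt, Equiv.Perm.mul_apply, act_move cs a X α w h0]
      have := ih t s (by rw [orderOf_swap]; omega) ⟨cs.simple s * w.1, isMin_move cs w.2 h0⟩ p
        (by omega) (by dsimp only; rw [rf_conj']; exact_mod_cast hl) (by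
          intro q hq
          dsimp only at hq
          rw [rf_conj'] at hq
          have := H _ hq
          rw [Nat.cast_succ, ← rf_conj, ← rf_conj] at this
          exact mul_left_cancel (mul_right_cancel this))
      dsimp only at this
      rw [rf_conj'] at this
      refine ⟨by exact_mod_cast this.1, ?_⟩
      rw [this.2, ralt, Nat.cast_succ, ← rf_conj]
      simp [mul_assoc]

theorem first_loop (p : ℕ) (s t : Fin n) (w : W) (hw : IsMin cs X w)
    (hl : w⁻¹ * rf cs s t p * w ∈ par cs X)
    (H : ∀ q : ℕ, q < p → w⁻¹ * rf cs s t q * w ∉ par cs X) :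
    ∃ x ∈ X, w⁻¹ * rf cs s t p * w = cs.simple x := by
  induction p generalizing s t w with
  | zero =>
    rw [Nat.cast_zero, rf_zero] at *
    exact isMin_loop cs hw hl
  | succ p ih =>
    have h0 := H 0 (by omega)
    rw [Nat.cast_zero, rf_zero] at h0
    have := ih t s (cs.simple s * w) (isMin_move cs hw h0) (by rw [rf_conj']; exact_mod_cast hl)
      (by intro q hq; rw [rf_conj']; exact_mod_cast H (q + 1) (by omega))
    rw [rf_conj'] at this
    exact_mod_cast this

theorem exists_min (L : Set (Fin n)) (w : W) :
    ∃ u ∈ par cs L, ∀ r ∈ par cs L, eta cs (u * w)⁻¹ r = 0 := by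
  classical
  have hex : ∃ k, ∃ u ∈ par cs L, cs.length (u * w) = k := ⟨_, 1, one_mem _, rfl⟩
  obtain ⟨u, hu, hk⟩ := Nat.find_spec hex
  refine ⟨u, hu, ?_⟩
  intro r hr
  by_contra hne
  obtain ⟨ω, hred, hω⟩ := cs.exists_isReduced (u * w)⁻¹
  rw [hω] at hne
  obtain ⟨ω', _, hlen, hprod⟩ := exchange cs ω r hne
  refine Nat.find_min hex (m := cs.length (r⁻¹ * u * w)) ?_
    ⟨r⁻¹ * u, mul_mem (inv_mem hr) hu, rfl⟩
  have e1 : r⁻¹ * u * w = (cs.wordProd ω')⁻¹ := by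
    rw [← hprod, ← hω]; group
  rw [← hk, e1, cs.length_inv, ← cs.length_inv (u * w), hω, hred]
  exact lt_of_le_of_lt (cs.length_wordProd_le _) hlen

theorem conj_par {L K : Set (Fin n)} (d : W) (h : ∀ s ∈ L, d * cs.simple s * d⁻¹ ∈ par cs K) :
    ∀ v ∈ par cs L, d * v * d⁻¹ ∈ par cs K := by
  intro v hv
  have : par cs L ≤ (par cs K).comap (MulAut.conj d).toMonoidHom := by
    rw [par, Subgroup.closure_le]
    rintro _ ⟨s, hs, rfl⟩
    simpa using h s hs
  simpa using this hv

theorem kilmoyer (i j s t : Fin n) (hij : i ≠ j) (hinj : Function.Injective cs.simple) (w : W)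
    (h : ∀ x ∈ ({i, j} : Set (Fin n)), w * cs.simple x * w⁻¹ ∈ par cs {s, t}) :
    ∀ y ∈ ({s, t} : Set (Fin n)), w⁻¹ * cs.simple y * w ∈ par cs {i, j} := by
  classical
  obtain ⟨u, hu, hmin⟩ := exists_min cs {s, t} w
  set d := u * w with hd
  have key : ∀ x ∈ ({i, j} : Set (Fin n)), ∃ y ∈ ({s, t} : Set (Fin n)),
      d * cs.simple x * d⁻¹ = cs.simple y := by
    intro x hx
    have hv : d * cs.simple x * d⁻¹ ∈ par cs {s, t} := by
      have : d * cs.simple x * d⁻¹ = u * (w * cs.simple x * w⁻¹) * u⁻¹ := by rw [hd]; group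
      rw [this]
      exact mul_mem (mul_mem hu (h x hx)) (inv_mem hu)
    apply par_simple cs hv hv
    intro r hr
    have e0 : ∀ r ∈ par cs {s, t}, eta cs d (d⁻¹ * r * d) = 0 := by
      intro r hr; rw [← eta_inv]; exact hmin r hr
    have e1 := eta_mul cs (d * cs.simple x * d⁻¹) d (d⁻¹ * r * d)
    rw [e0 r hr, zero_add, show d * cs.simple x * d⁻¹ * d = d * cs.simple x by group, eta_mul,
      eta_simple, show d * (d⁻¹ * r * d) * d⁻¹ = r by group] at e1
    have e2 : cs.simple x * (d⁻¹ * r * d) * (cs.simple x)⁻¹ =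
        d⁻¹ * ((d * cs.simple x * d⁻¹) * r * (d * cs.simple x * d⁻¹)⁻¹) * d := by group
    rw [e2, e0 _ (mul_mem (mul_mem hv hr) (inv_mem hv)), add_zero] at e1
    rw [← e1]
    have : d⁻¹ * r * d = cs.simple x ↔ r = d * cs.simple x * d⁻¹ := by
      constructor
      · intro h; rw [← h]; group
      · intro h; rw [h]; group
    simp [this]
  have key2 : ∀ y ∈ ({s, t} : Set (Fin n)), d⁻¹ * cs.simple y * d⁻¹⁻¹ ∈ par cs {i, j} := by
    obtain ⟨y1, hy1, e1⟩ := key i (by simp)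
    obtain ⟨y2, hy2, e2⟩ := key j (by simp)
    have hne : y1 ≠ y2 := by
      rintro rfl
      rw [← e2] at e1
      exact hij (hinj (mul_left_cancel (mul_right_cancel e1)))
    have m1 : d⁻¹ * cs.simple y1 * d⁻¹⁻¹ ∈ par cs {i, j} := by
      rw [← e1, show d⁻¹ * (d * cs.simple i * d⁻¹) * d⁻¹⁻¹ = cs.simple i by group]
      exact simple_mem_par cs (by simp)
    have m2 : d⁻¹ * cs.simple y2 * d⁻¹⁻¹ ∈ par cs {i, j} := by
      rw [← e2, show d⁻¹ * (d * cs.simple j * d⁻¹) * d⁻¹⁻¹ = cs.simple j by group]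
      exact simple_mem_par cs (by simp)
    simp only [Set.mem_insert_iff, Set.mem_singleton_iff] at hy1 hy2
    rintro y (rfl | rfl) <;> rcases hy1 with rfl | rfl <;> rcases hy2 with rfl | rfl <;>
      first | exact m1 | exact m2 | exact absurd rfl hne
  intro y hy
  have := conj_par cs d⁻¹ key2 (u * cs.simple y * u⁻¹)
    (mul_mem (mul_mem hu (simple_mem_par cs hy)) (inv_mem hu))
  have e : d⁻¹ * (u * cs.simple y * u⁻¹) * d⁻¹⁻¹ = w⁻¹ * cs.simple y * w := by rw [hd]; group
  rwa [e] at this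

theorem walk_all (k : ℕ) (s t : Fin n) (hinj : Function.Injective cs.simple)
    (α : A) (w : {w : W // IsMin cs X w}) (x y : Fin n) (hx : x ∈ X) (hy : y ∈ X)
    (hsx : w.1⁻¹ * cs.simple s * w.1 = cs.simple x)
    (hty : w.1⁻¹ * cs.simple t * w.1 = cs.simple y) :
    ralt (act cs a X s) (act cs a X t) k (α, w) = (ralt (a x) (a y) k * α, w) := by
  induction k generalizing s t x y α with
  | zero => simp [ralt]
  | succ k ih =>
    rw [ralt, Equiv.Perm.mul_apply, act_loop cs a X α w (hsx ▸ simple_mem_par cs hx),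
      ih t s _ y x hy hx hty hsx, hsx, labOf_simple cs a X hinj hx, ralt, mul_assoc]

end

theorem rf_mod (s t : Fin n) (q : ℤ) (h0 : 0 < orderOf (cs.simple s * cs.simple t)) :
    ∃ p : ℕ, p < orderOf (cs.simple s * cs.simple t) ∧ rf cs s t q = rf cs s t p ∧
      (p : ℤ) = q % (orderOf (cs.simple s * cs.simple t) : ℕ) := by
  have h1 := Int.emod_nonneg q (b := (orderOf (cs.simple s * cs.simple t) : ℕ)) (by omega)
  have h2 := Int.emod_lt_of_pos q (b := (orderOf (cs.simple s * cs.simple t) : ℕ)) (by omega)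
  refine ⟨(q % (orderOf (cs.simple s * cs.simple t) : ℕ)).toNat, by omega, ?_, by omega⟩
  rw [rf_eq_iff, Int.toNat_of_nonneg h1]
  exact Int.dvd_self_sub_emod

theorem rf_mem (s t : Fin n) (q : ℤ) : rf cs s t q ∈ par cs {s, t} :=
  mul_mem (zpow_mem (mul_mem (simple_mem_par cs (by simp)) (simple_mem_par cs (by simp))) _)
    (simple_mem_par cs (by simp))

theorem braid {A : Type} [Group A] (a : Fin n → A)
    (h3 : ∀ i j, i ≠ j → C i j = 0 ∨ 3 ≤ C i j) (i j : Fin n) (hij : i ≠ j) (hC : C i j ≠ 0)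
    (ha : ralt (a i) (a j) (C i j) = ralt (a j) (a i) (C i j))
    (s t : Fin n) (hst : s ≠ t) (h0 : C s t ≠ 0) :
    ralt (act cs a {i, j} s) (act cs a {i, j} t) (C s t) =
      ralt (act cs a {i, j} t) (act cs a {i, j} s) (C s t) := by
  classical
  have hinj := simple_inj C cs h3
  have hord : ∀ s t, s ≠ t → C s t ≠ 0 → orderOf (cs.simple s * cs.simple t) = C s t := by
    intro s t hst h0
    apply Nat.dvd_antisymm
    · exact orderOf_dvd_of_pow_eq_one (cs.simple_mul_simple_pow s t)
    · exact dvd_of_pow_eq_one C cs h3 s t hst h0 _ (pow_orderOf_eq_one _)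
  have ho := hord s t hst h0
  have ho' := orderOf_swap cs s t
  have hg : ralt (cs.simple s) (cs.simple t) (C s t) = ralt (cs.simple t) (cs.simple s) (C s t) := by
    rw [ralt_swap (cs.simple s) (cs.simple t) (by simp) (by simp), cs.simple_mul_simple_pow, mul_one]
  set m := C s t with hm
  set X : Set (Fin n) := {i, j} with hX
  have hpos : 0 < orderOf (cs.simple s * cs.simple t) := by omega
  have hpos' : 0 < orderOf (cs.simple t * cs.simple s) := by omega
  ext1 ⟨α, w⟩
  by_cases hnone : ∀ q : ℤ, w.1⁻¹ * rf cs s t q * w.1 ∉ par cs X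
  · obtain ⟨a1, a2⟩ := walk_none cs a X m s t α w (fun q _ => hnone q)
    obtain ⟨b1, b2⟩ := walk_none cs a X m t s α w (fun q _ => by rw [rf_swap]; exact hnone _)
    refine Prod.ext (a1.trans b1.symm) (Subtype.ext ?_)
    rw [a2, b2, hg]
  push Not at hnone
  obtain ⟨q0, hq0⟩ := hnone
  by_cases huniq : ∀ q : ℤ, w.1⁻¹ * rf cs s t q * w.1 ∈ par cs X → rf cs s t q = rf cs s t q0
  · obtain ⟨p, hp, ep, -⟩ := rf_mod cs s t q0 hpos
    obtain ⟨p', hp', ep', -⟩ := rf_mod cs t s (-q0 - 1) hpos'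
    have ep2 : rf cs s t q0 = rf cs t s p' := by rw [← ep', rf_swap]
    obtain ⟨a1, a2⟩ := walk_one cs a X m s t (by omega) α w p (by omega) (by rwa [← ep])
      (by rwa [← ep])
    obtain ⟨b1, b2⟩ := walk_one cs a X m t s (by omega) α w p' (by omega) (by rwa [← ep2])
      (by
        rw [← ep2]
        intro q hq
        rw [rf_swap] at hq ⊢
        exact huniq _ hq)
    refine Prod.ext ?_ (Subtype.ext ?_)
    · rw [a1, b1, ← ep, ← ep2]
    · rw [a2, b2, ← ep, ← ep2, hg]
  have hex : ∃ p : ℕ, w.1⁻¹ * rf cs s t p * w.1 ∈ par cs X := by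
    obtain ⟨p, hp, ep, -⟩ := rf_mod cs s t q0 hpos
    exact ⟨p, by rwa [← ep]⟩
  have hex' : ∃ p : ℕ, w.1⁻¹ * rf cs t s p * w.1 ∈ par cs X := by
    obtain ⟨p', hp', ep', -⟩ := rf_mod cs t s (-q0 - 1) hpos'
    refine ⟨p', ?_⟩
    rw [← ep', rf_swap]
    convert hq0 using 4
    ring
  obtain ⟨x, hx, ex⟩ := first_loop cs X (Nat.find hex) s t w.1 w.2 (Nat.find_spec hex)
    (fun q hq => Nat.find_min hex hq)
  obtain ⟨y, hy, ey⟩ := first_loop cs X (Nat.find hex') t s w.1 w.2 (Nat.find_spec hex')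
    (fun q hq => Nat.find_min hex' hq)
  have hmin : ∀ q : ℕ, w.1⁻¹ * rf cs s t q * w.1 ∈ par cs X → Nat.find hex ≤ q :=
    fun q hq => Nat.find_min' hex hq
  have hmin' : ∀ q : ℕ, w.1⁻¹ * rf cs t s q * w.1 ∈ par cs X → Nat.find hex' ≤ q :=
    fun q hq => Nat.find_min' hex' hq
  generalize Nat.find hex = p at *
  generalize Nat.find hex' = p' at *
  have hxy : x ≠ y := by
    rintro rfl
    apply huniq
    rw [← ey] at ex
    have e1 : rf cs s t p = rf cs t s p' := mul_left_cancel (mul_right_cancel ex)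
    rw [rf_swap cs s t, rf_eq_iff, ho] at e1
    have key : ∀ q : ℤ, w.1⁻¹ * rf cs s t q * w.1 ∈ par cs X → rf cs s t q = rf cs s t p := by
      intro q hq
      obtain ⟨e, he, ee, ee2⟩ := rf_mod cs s t q hpos
      have f1 := hmin e (by rwa [← ee])
      have f2 := hmin' (m - 1 - e) (by
        rw [rf_swap]
        have : rf cs s t (-((m - 1 - e : ℕ) : ℤ) - 1) = rf cs s t e := by
          rw [rf_eq_iff, ho]
          exact ⟨-1, by omega⟩
        rw [this, ← ee]; exact hq)
      have e2 : (m : ℤ) ∣ ((p + p' + 1 : ℕ) : ℤ) := by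
        convert e1 using 1; push_cast; ring
      have e3 := Nat.le_of_dvd (by omega) (Int.natCast_dvd_natCast.1 e2)
      have : e = p := by omega
      rw [ee, this]
    intro q hq
    rw [key q hq, key q0 hq0]
  have hall := kilmoyer cs i j s t hij hinj w.1 (by
    have hx1 : w.1 * cs.simple x * w.1⁻¹ ∈ par cs {s, t} := by
      rw [← ex, show w.1 * (w.1⁻¹ * rf cs s t p * w.1) * w.1⁻¹ = rf cs s t p by group]
      exact rf_mem cs s t p
    have hy1 : w.1 * cs.simple y * w.1⁻¹ ∈ par cs {s, t} := by
      rw [← ey, show w.1 * (w.1⁻¹ * rf cs t s p' * w.1) * w.1⁻¹ = rf cs t s p' by group, rf_swap]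
      exact rf_mem cs s t _
    simp only [hX, Set.mem_insert_iff, Set.mem_singleton_iff] at hx hy
    rintro z (rfl | rfl) <;> rcases hx with rfl | rfl <;> rcases hy with rfl | rfl <;>
      first | exact hx1 | exact hy1 | exact absurd rfl hxy)
  obtain ⟨x1, hx1, ex1⟩ := isMin_loop cs w.2 (hall s (by simp))
  obtain ⟨y1, hy1, ey1⟩ := isMin_loop cs w.2 (hall t (by simp))
  have hne : x1 ≠ y1 := by
    rintro rfl
    rw [← ey1] at ex1
    exact hst (hinj (mul_left_cancel (mul_right_cancel ex1)))
  rw [walk_all cs a X m s t hinj α w x1 y1 hx1 hy1 ex1 ey1,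
    walk_all cs a X m t s hinj α w y1 x1 hy1 hx1 ey1 ex1]
  have hconj : orderOf (cs.simple x1 * cs.simple y1) = orderOf (cs.simple s * cs.simple t) := by
    rw [← ex1, ← ey1]
    have : w.1⁻¹ * cs.simple s * w.1 * (w.1⁻¹ * cs.simple t * w.1) =
      MulAut.conj w.1⁻¹ (cs.simple s * cs.simple t) := by simp [mul_assoc]
    rw [this, MulEquiv.orderOf_eq]
  simp only [hX, Set.mem_insert_iff, Set.mem_singleton_iff] at hx1 hy1
  have hmij : m = C i j := by
    rw [← ho, ← hconj, ← hord i j hij hC]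
    rcases hx1 with rfl | rfl <;> rcases hy1 with rfl | rfl
    · exact absurd rfl hne
    · rfl
    · exact orderOf_swap cs _ _
    · exact absurd rfl hne
  rw [hmij]
  rcases hx1 with rfl | rfl <;> rcases hy1 with rfl | rfl
  · exact absurd rfl hne
  · rw [ha]
  · rw [ha]
  · exact absurd rfl hne

/-- the Coxeter matrix -/
def cmat (n : ℕ) (M : Fin n → Fin n → ℕ∞)
    (hsym : ∀ i j, M i j = M j i) (hM : ∀ i j, i ≠ j → 4 ≤ M i j) : CoxeterMatrix (Fin n) where
  M := Matrix.of fun i j => if i = j then 1 else (M i j).toNat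
  isSymm := by
    ext i j
    simp [Matrix.transpose_apply, hsym i j, eq_comm]
  diagonal i := by simp
  off_diagonal i j hij := by
    have := hM i j hij
    simp only [Matrix.of_apply, if_neg hij]
    intro h1
    rw [ENat.toNat_eq_iff (by norm_num)] at h1
    rw [h1] at this
    norm_num at this

theorem cmat_apply (n : ℕ) (M : Fin n → Fin n → ℕ∞)
    (hsym : ∀ i j, M i j = M j i) (hM : ∀ i j, i ≠ j → 4 ≤ M i j) {i j : Fin n} (hij : i ≠ j) :
    cmat n M hsym hM i j = (M i j).toNat := by
  simp [cmat, hij]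

theorem cmat_h3 (n : ℕ) (M : Fin n → Fin n → ℕ∞)
    (hsym : ∀ i j, M i j = M j i) (hM : ∀ i j, i ≠ j → 4 ≤ M i j) (i j : Fin n) (hij : i ≠ j) :
    cmat n M hsym hM i j = 0 ∨ 3 ≤ cmat n M hsym hM i j := by
  rw [cmat_apply n M hsym hM hij]
  have := hM i j hij
  by_cases h : M i j = ⊤
  · left; simp [h]
  · right
    obtain ⟨m, hm⟩ := ENat.ne_top_iff_exists.1 h
    rw [← hm] at this ⊢
    have h4 : 4 ≤ m := by exact_mod_cast this
    simp; omega

theorem main_aux (n : ℕ) (M : Fin n → Fin n → ℕ∞)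
    (hsym : ∀ i j, M i j = M j i) (hM : ∀ i j, i ≠ j → 4 ≤ M i j)
    (i j t k : Fin n) (hij : i ≠ j)
    (hdisj : ({i, j} : Set (Fin n)) ∩ {t, k} = ∅)
    (hfinij : M i j ≠ ⊤)
    (g : PresentedGroup (artinRels n M))
    (h1 : g ∈ Subgroup.closure {artinMk n M (FreeGroup.of i), artinMk n M (FreeGroup.of j)})
    (h2 : g ∈ Subgroup.closure {artinMk n M (FreeGroup.of t), artinMk n M (FreeGroup.of k)}) :
    g = 1 := by
  set C := cmat n M hsym hM with hC
  have h3 : ∀ i j, i ≠ j → C i j = 0 ∨ 3 ≤ C i j := cmat_h3 n M hsym hM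
  have hCm : ∀ x y, x ≠ y → ∀ m : ℕ, M x y = m → C x y = m ∧ C x y ≠ 0 := by
    intro x y hxy m hm
    have e : C x y = m := by rw [hC, cmat_apply n M hsym hM hxy, hm]; simp
    have := hM x y hxy
    rw [hm] at this
    have h4 : 4 ≤ m := by exact_mod_cast this
    omega
  let cs := C.toCoxeterSystem
  have hinj := simple_inj C cs h3
  let a : Fin n → PresentedGroup (artinRels n M) := fun s => artinMk n M (FreeGroup.of s)
  have hlift : FreeGroup.lift a = artinMk n M := by
    ext s; simp [a]
  obtain ⟨m0, hm0⟩ := ENat.ne_top_iff_exists.1 hfinij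
  obtain ⟨hCij, hCij0⟩ := hCm i j hij m0 hm0.symm
  have ha : ralt (a i) (a j) (C i j) = ralt (a j) (a i) (C i j) := by
    rw [← lift_altWord_eq_iff, hlift, hCij, ← mul_inv_eq_one, ← map_inv, ← map_mul]
    exact PresentedGroup.one_of_mem ⟨i, j, hij, m0, hm0.symm, rfl⟩
  have hrel : ∀ r ∈ artinRels n M, FreeGroup.lift (act cs a {i, j}) r = 1 := by
    rintro r ⟨x, y, hxy, m, hm, rfl⟩
    obtain ⟨e1, e2⟩ := hCm x y hxy m hm
    rw [map_mul, map_inv, mul_inv_eq_one, lift_altWord_eq_iff, ← e1]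
    exact braid cs a h3 i j hij hCij0 ha x y hxy e2
  let φ := PresentedGroup.toGroup hrel
  have hφ : ∀ s, φ (a s) = act cs a {i, j} s := fun s => PresentedGroup.toGroup.of hrel
  let o : {w : C.Group // IsMin cs {i, j} w} := ⟨1, isMin_one cs _⟩
  have c1 : ∀ α, φ g (α, o) = (g * α, o) := by
    clear h2
    induction h1 using Subgroup.closure_induction with
    | mem x hx =>
      have : ∃ s ∈ ({i, j} : Set (Fin n)), x = a s := by
        rcases hx with rfl | rfl
        · exact ⟨i, by simp, rfl⟩
        · exact ⟨j, by simp, rfl⟩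
      obtain ⟨s, hs, rfl⟩ := this
      intro α
      have e : o.1⁻¹ * cs.simple s * o.1 = cs.simple s := by simp [o]
      rw [hφ, act_loop cs a _ α o (by rw [e]; exact simple_mem_par cs hs), e,
        labOf_simple cs a _ hinj hs]
    | one => simp
    | mul x y _ _ hx hy =>
      intro α
      rw [map_mul, Equiv.Perm.mul_apply, hy, hx, mul_assoc]
    | inv x _ hx =>
      intro α
      rw [map_inv, Equiv.Perm.inv_eq_iff_eq, hx, mul_inv_cancel_left]
  have noloop : ∀ s ∈ ({t, k} : Set (Fin n)), ∀ w : {w : C.Group // IsMin cs {i, j} w},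
      w.1 ∈ par cs {t, k} → w.1⁻¹ * cs.simple s * w.1 ∉ par cs {i, j} := by
    classical
    intro s hs w hw hmem
    obtain ⟨x, hx, ex⟩ := isMin_loop cs w.2 hmem
    have hxY : cs.simple x ∈ par cs {t, k} := by
      rw [← ex]
      exact mul_mem (mul_mem (inv_mem hw) (simple_mem_par cs hs)) hw
    obtain ⟨y, hy, ey⟩ := par_simple cs hxY hxY (by intro r _; rw [eta_simple]; simp)
    have hxy := hinj ey
    have : x ∈ ({i, j} : Set (Fin n)) ∩ {t, k} := ⟨hx, hxy ▸ hy⟩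
    rw [hdisj] at this
    exact this
  have gen : ∀ x ∈ ({artinMk n M (FreeGroup.of t), artinMk n M (FreeGroup.of k)} : Set _),
      ∃ s ∈ ({t, k} : Set (Fin n)), x = a s := by
    intro x hx
    rcases hx with rfl | rfl
    · exact ⟨t, by simp, rfl⟩
    · exact ⟨k, by simp, rfl⟩
  have c2 : ∀ α (w : {w : C.Group // IsMin cs {i, j} w}), w.1 ∈ par cs {t, k} →
      (φ g (α, w)).1 = α ∧ (φ g (α, w)).2.1 ∈ par cs {t, k} := by
    clear h1 c1
    induction h2 using Subgroup.closure_induction'' with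
    | mem x hx =>
      obtain ⟨s, hs, rfl⟩ := gen x hx
      intro α w hw
      rw [hφ, act_move cs a _ α w (noloop s hs w hw)]
      exact ⟨rfl, mul_mem (simple_mem_par cs hs) hw⟩
    | inv_mem x hx =>
      obtain ⟨s, hs, rfl⟩ := gen x hx
      intro α w hw
      rw [map_inv, hφ, act_symm_move cs a _ α w (noloop s hs w hw)]
      exact ⟨rfl, mul_mem (simple_mem_par cs hs) hw⟩
    | one => intro α w hw; simpa using hw
    | mul x y _ _ hx hy =>
      intro α w hw
      obtain ⟨p1, p2⟩ := hy α w hw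
      obtain ⟨q1, q2⟩ := hx _ _ p2
      rw [map_mul, Equiv.Perm.mul_apply]
      exact ⟨q1.trans p1, q2⟩
  have := (c2 1 o (one_mem _)).1
  rw [c1 1] at this
  simpa using this

end ArtinAux

/-- (Appel–Schupp) In an Artin group all of whose labels satisfy `m_{ij} ≥ 4`, if
`{i,j}` and `{t,k}` are disjoint pairs with `m_{ij}, m_{tk} < ∞`, then the parabolic
subgroups `G_{ij} = ⟨a_i, a_j⟩` and `G_{tk} = ⟨a_t, a_k⟩` intersect trivially. -/
theorem artin_parabolic_inter_eq_bot (n : ℕ) (M : Fin n → Fin n → ℕ∞)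
    (hsym : ∀ i j, M i j = M j i) (hM : ∀ i j, i ≠ j → 4 ≤ M i j)
    (i j t k : Fin n) (hij : i ≠ j) (htk : t ≠ k)
    (hdisj : ({i, j} : Set (Fin n)) ∩ {t, k} = ∅)
    (hfinij : M i j ≠ ⊤) (hfintk : M t k ≠ ⊤) :
    Subgroup.closure {artinMk n M (FreeGroup.of i), artinMk n M (FreeGroup.of j)} ⊓
      Subgroup.closure {artinMk n M (FreeGroup.of t), artinMk n M (FreeGroup.of k)} =
    ⊥ := by
  rw [eq_bot_iff]
  rintro g ⟨h1, h2⟩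
  exact ArtinAux.main_aux n M hsym hM i j t k hij hdisj hfinij g h1 h2
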